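/- For every C¹ function ψ : S¹ → ℝ and every n ∈ ℕ, the function Lⁿψ is C¹ and ‖(Lⁿψ)'‖_{L¹(m)} ≤ λ⁻ⁿ‖ψ'‖_{L¹(m)} + Ω·‖ψ‖_{L¹(m)}. -/

import Mathlib

open MeasureTheory Real

lemma aux_shift (F : ℝ → ℝ) (w : ℕ) (hFw : ∀ x : ℝ, F (x + 1) = F x + w) (x : ℝ) (z : ℤ) :
    F (x + z) = F x + z * w := by
  have hp : Function.Periodic (fun x => F x - w * x) 1 := by
    intro x
    simp only [hFw]; ring
  have := hp.int_mul z x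
  simp only [mul_one] at this
  linarith

lemma aux_inv (F : ℝ → ℝ) (hF : ContDiff ℝ 2 F) (lam : ℝ) (hlam : 1 < lam)
    (hexp : ∀ x : ℝ, lam ≤ deriv F x) :
    ∃ G : ℝ → ℝ, (∀ x, F (G x) = x) ∧ (∀ x, G (F x) = x) ∧
      (∀ x, HasDerivAt G (deriv F (G x))⁻¹ x) := by
  have hd : Differentiable ℝ F := hF.differentiable (by norm_num)
  have hpos : ∀ x, 0 < deriv F x := fun x => by linarith [hexp x]
  have hmono : StrictMono F := strictMono_of_deriv_pos hpos
  have hm : Monotone (fun x => F x - x) := by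
    apply monotone_of_deriv_nonneg (hd.sub differentiable_id)
    intro x
    have : HasDerivAt (fun x => F x - x) (deriv F x - 1) x := (hd x).hasDerivAt.sub (hasDerivAt_id x)
    change 0 ≤ deriv (fun x => F x - x) x
    rw [this.deriv]; linarith [hexp x]
  have htop : Filter.Tendsto F Filter.atTop Filter.atTop := by
    apply Filter.tendsto_atTop_mono' _ _ (Filter.tendsto_atTop_add_const_right _ (F 0) Filter.tendsto_id)
    filter_upwards [Filter.eventually_ge_atTop 0] with x hx
    have := hm hx
    simp at this ⊢; linarith
  have hbot : Filter.Tendsto F Filter.atBot Filter.atBot := by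
    apply Filter.tendsto_atBot_mono' _ _ (Filter.tendsto_atBot_add_const_right _ (F 0) Filter.tendsto_id)
    filter_upwards [Filter.eventually_le_atBot 0] with x hx
    have := hm hx
    simp at this ⊢; linarith
  have hs : Function.Surjective F := hd.continuous.surjective htop hbot
  let e := hmono.orderIsoOfSurjective F hs
  have h1 : ∀ x, F (e.symm x) = x := fun x => e.apply_symm_apply x
  refine ⟨e.symm, h1, fun x => e.symm_apply_apply x, fun x => ?_⟩
  exact HasDerivAt.of_local_left_inverse e.symm.continuous.continuousAt (hd _).hasDerivAt
    (hpos _).ne' (Filter.Eventually.of_forall h1)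

lemma aux_int (w : ℕ) (G G' : ℝ → ℝ) (hG : ∀ x, HasDerivAt G (G' x) x) (hG' : Continuous G')
    (hpos : ∀ x, 0 ≤ G' x) (hGw : G w = G 0 + 1)
    (v : ℝ → ℝ) (hv : Continuous v) (hper : Function.Periodic v 1) :
    ∫ x in (0:ℝ)..1, |∑ k : Fin w, v (G (x + (k:ℕ))) * G' (x + (k:ℕ))| ≤ ∫ x in (0:ℝ)..1, |v x| := by
  have hGc : Continuous G := continuous_iff_continuousAt.2 fun x => (hG x).continuousAt
  let h : ℝ → ℝ := fun y => |v (G y)| * G' y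
  have hh : Continuous h := by fun_prop
  calc _ ≤ ∫ x in (0:ℝ)..1, ∑ k : Fin w, h (x + (k:ℕ)) := by
        apply intervalIntegral.integral_mono_on zero_le_one
        · exact Continuous.intervalIntegrable (by fun_prop) _ _
        · exact Continuous.intervalIntegrable (by fun_prop) _ _
        · intro x _
          refine (Finset.abs_sum_le_sum_abs _ _).trans (le_of_eq ?_)
          refine Finset.sum_congr rfl fun k _ => ?_
          simp only [h, abs_mul, abs_of_nonneg (hpos _)]
    _ = ∑ k : Fin w, ∫ x in (0:ℝ)..1, h (x + (k:ℕ)) :=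
        intervalIntegral.integral_finsetSum fun k _ =>
          Continuous.intervalIntegrable (by fun_prop) _ _
    _ = ∑ k ∈ Finset.range w, ∫ x in (k:ℝ)..((k+1:ℕ):ℝ), h x := by
        rw [Finset.sum_range]
        refine Finset.sum_congr rfl fun k _ => ?_
        rw [intervalIntegral.integral_comp_add_right]
        congr 1 <;> push_cast <;> ring
    _ = ∫ x in ((0:ℕ):ℝ)..w, h x :=
        intervalIntegral.sum_integral_adjacent_intervals (a := fun k : ℕ => (k:ℝ))
          fun k _ => hh.intervalIntegrable _ _
    _ = ∫ x in (G 0)..(G w), |v x| := by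
        have := intervalIntegral.integral_comp_mul_deriv (a := 0) (b := w) (f := G) (f' := G')
          (g := fun x => |v x|) (fun x _ => hG x) hG'.continuousOn (by fun_prop)
        simpa [h] using this
    _ = ∫ x in (0:ℝ)..1, |v x| := by
        have hp : Function.Periodic (fun x => |v x|) 1 := fun x => by simp only [hper x]
        rw [hGw, hp.intervalIntegral_add_eq (G 0) 0, zero_add]

lemma aux_sum (F : ℝ → ℝ) (w : ℕ) (hw : 0 < w) (hFw : ∀ x : ℝ, F (x + 1) = F x + w)
    (T : UnitAddCircle → UnitAddCircle) (hT : ∀ x : ℝ, T ↑x = (↑(F x) : UnitAddCircle))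
    (G : ℝ → ℝ) (h1 : ∀ x, F (G x) = x) (h2 : ∀ x, G (F x) = x)
    (f : UnitAddCircle → ℝ) (x : ℝ) :
    ∑' y : (T ⁻¹' {(x : UnitAddCircle)}), f y = ∑ k : Fin w, f (G (x + (k:ℕ)) : ℝ) := by
  have hz : ∀ (a b : ℝ), (a : UnitAddCircle) = b ↔ ∃ z : ℤ, a = b + z := by
    intro a b
    rw [← sub_eq_zero, ← AddCircle.coe_sub, AddCircle.coe_eq_zero_iff]
    constructor
    · rintro ⟨z, h⟩; exact ⟨z, by simp at h; linarith⟩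
    · rintro ⟨z, h⟩; exact ⟨z, by simp; linarith⟩
  let e : Fin w → (T ⁻¹' {(x : UnitAddCircle)}) := fun k => ⟨((G (x + (k:ℕ)) : ℝ) : UnitAddCircle), by
    simp only [Set.mem_preimage, Set.mem_singleton_iff, hT, h1]
    exact (hz _ _).2 ⟨(k:ℕ), by simp⟩⟩
  have he : Function.Bijective e := by
    constructor
    · intro j k hjk
      have := congrArg Subtype.val hjk
      obtain ⟨z, h⟩ := (hz _ _).1 this
      have h3 := congrArg F h
      rw [aux_shift F w hFw, h1, h1] at h3
      have h4 : ((j:ℕ):ℤ) = (k:ℕ) + z * w := by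
        have : (((j:ℕ):ℤ):ℝ) = (((k:ℕ) + z * w : ℤ) : ℝ) := by push_cast; linarith
        exact_mod_cast this
      have h5 := congrArg (· % (w:ℤ)) h4
      simp only [Int.add_mul_emod_self_right] at h5
      rw [Int.emod_eq_of_lt (by omega) (by omega), Int.emod_eq_of_lt (by omega) (by omega)] at h5
      exact Fin.ext (by exact_mod_cast h5)
    · rintro ⟨y, hy⟩
      obtain ⟨t, rfl⟩ := QuotientAddGroup.mk_surjective y
      have hy' : ((F t : ℝ) : UnitAddCircle) = x := by rw [← hT]; exact hy
      obtain ⟨z, h⟩ := (hz _ _).1 hy'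
      have hw' : (0:ℤ) < w := by exact_mod_cast hw
      have hr0 := Int.emod_nonneg z hw'.ne'
      have hr1 := Int.emod_lt_of_pos z hw'
      obtain ⟨r, hr⟩ := Int.eq_ofNat_of_zero_le hr0
      have hrw : r < w := by omega
      refine ⟨⟨r, hrw⟩, Subtype.ext ?_⟩
      change ((G (x + (r:ℕ)) : ℝ) : UnitAddCircle) = (t : UnitAddCircle)
      refine (hz _ _).2 ⟨-(z / w), ?_⟩
      have h6 := aux_shift F w hFw t (-(z / w))
      have h7 := Int.emod_add_mul_ediv z w
      rw [hr] at h7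
      have h8 : ((r:ℝ)) + w * ((z / w : ℤ):ℝ) = z := by exact_mod_cast h7
      rw [← h2 (t + _), h6, h]
      congr 1
      push_cast
      linarith
  rw [← (Equiv.ofBijective e he).tsum_eq, tsum_fintype]
  rfl

lemma aux_step
    (F : ℝ → ℝ) (hF : ContDiff ℝ 2 F)
    (w : ℕ) (hw : 0 < w) (hFw : ∀ x : ℝ, F (x + 1) = F x + w)
    (T : UnitAddCircle → UnitAddCircle) (hT : ∀ x : ℝ, T ↑x = (↑(F x) : UnitAddCircle))
    (lam : ℝ) (hlam : 1 < lam) (hexp : ∀ x : ℝ, lam ≤ deriv F x)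
    (M : ℝ) (hM : M = ⨆ x : ℝ, |deriv (deriv F) x|)
    (T' : UnitAddCircle → ℝ) (hT'lift : ∀ x : ℝ, T' ↑x = deriv F x)
    (L : (UnitAddCircle → ℝ) → (UnitAddCircle → ℝ))
    (hL : ∀ u : UnitAddCircle → ℝ, ∀ x : UnitAddCircle,
      L u x = ∑' y : (T ⁻¹' {x}), u y / T' y)
    (ψ : UnitAddCircle → ℝ) (hψ : ContDiff ℝ 1 (fun x : ℝ => ψ ↑x)) :
    ContDiff ℝ 1 (fun x : ℝ => (L ψ) ↑x) ∧
      (∫ x in (0:ℝ)..1, |L ψ ↑x|) ≤ (∫ x in (0:ℝ)..1, |ψ ↑x|) ∧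
      (∫ x in (0:ℝ)..1, |deriv (fun y : ℝ => (L ψ) ↑y) x|) ≤
        (1 / lam) * (∫ x in (0:ℝ)..1, |deriv (fun y : ℝ => ψ ↑y) x|)
          + M / lam ^ 2 * ∫ x in (0:ℝ)..1, |ψ ↑x| := by
  obtain ⟨G, h1, h2, hG⟩ := aux_inv F hF lam hlam hexp
  have hpos : ∀ x, 0 < deriv F x := fun x => by linarith [hexp x]
  have hdF : ContDiff ℝ 1 (deriv F) := ((contDiff_succ_iff_deriv (n := 1)).1 hF).2.2
  have hddF : Continuous (deriv (deriv F)) := hdF.continuous_deriv le_rfl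
  have hdFc : Continuous (deriv F) := hdF.continuous
  have hGc : Continuous G := continuous_iff_continuousAt.2 fun x => (hG x).continuousAt
  have hG'c : Continuous (fun x => (deriv F (G x))⁻¹) :=
    (hdFc.comp hGc).inv₀ fun x => (hpos _).ne'
  have hGC : ContDiff ℝ 1 G := by
    rw [contDiff_one_iff_deriv]
    refine ⟨fun x => (hG x).differentiableAt, ?_⟩
    rwa [show deriv G = fun x => (deriv F (G x))⁻¹ from funext fun x => (hG x).deriv]
  have hGw : G w = G 0 + 1 := by
    rw [← h2 (G 0 + 1), hFw, h1, zero_add]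
  have hperF : Function.Periodic (deriv F) 1 := fun x => by
    rw [← hT'lift, ← hT'lift, AddCircle.coe_add, AddCircle.coe_period, add_zero]
  have hder : ∀ {f : ℝ → ℝ}, Function.Periodic f 1 → Function.Periodic (deriv f) 1 := by
    intro f hf x
    rw [← deriv_comp_add_const]
    congr 1
    exact funext hf
  have hMb : ∀ x, |deriv (deriv F) x| ≤ M := by
    rw [hM]
    obtain ⟨C, hC⟩ := (isCompact_Icc (a := (0:ℝ)) (b := 1)).exists_bound_of_continuousOn
      hddF.continuousOn
    apply le_ciSup (f := fun x => |deriv (deriv F) x|)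
    refine ⟨C, ?_⟩
    rintro _ ⟨x, rfl⟩
    obtain ⟨y, hy, hxy⟩ := (hder hperF).exists_mem_Ico₀ one_pos x
    simp only [hxy]
    exact hC y ⟨hy.1, hy.2.le⟩
  have hψper : Function.Periodic (fun x : ℝ => ψ ↑x) 1 := fun x => by
    simp only [AddCircle.coe_add, AddCircle.coe_period, add_zero]
  set p : ℝ → ℝ := fun x => ψ ↑x with hp
  have hq : ∀ x : ℝ, L ψ x = ∑ k : Fin w, p (G (x + (k:ℕ))) / deriv F (G (x + (k:ℕ))) := by
    intro x
    rw [hL, aux_sum F w hw hFw T hT G h1 h2 (fun y => ψ y / T' y) x]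
    simp only [hT'lift, hp]
  have hr : ContDiff ℝ 1 (fun x => p x / deriv F x) := hψ.div hdF fun x => (hpos x).ne'
  have hrd : ∀ x, HasDerivAt (fun x => p x / deriv F x)
      ((deriv p x * deriv F x - p x * deriv (deriv F) x) / (deriv F x)^2) x := fun x =>
    ((hψ.differentiable one_ne_zero x).hasDerivAt).div
      ((hdF.differentiable one_ne_zero x).hasDerivAt) (hpos x).ne'
  have hdp : Continuous (deriv p) := hψ.continuous_deriv le_rfl
  have hpc : Continuous p := hψ.continuous
  set v : ℝ → ℝ := fun x => (deriv p x * deriv F x - p x * deriv (deriv F) x) / (deriv F x)^2 with hv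
  have hvc : Continuous v := by
    apply Continuous.div (by fun_prop) (by fun_prop)
    intro x; exact pow_ne_zero _ (hpos x).ne'
  have hvper : Function.Periodic v 1 := fun x => by
    simp only [hv, hperF x, hder hperF x, hψper x, hder hψper x]
  have hLeq : (fun x : ℝ => L ψ x) = fun x => ∑ k : Fin w, p (G (x + (k:ℕ))) / deriv F (G (x + (k:ℕ))) :=
    funext hq
  have hLd : ∀ x, deriv (fun x : ℝ => L ψ x) x =
      ∑ k : Fin w, v (G (x + (k:ℕ))) * (deriv F (G (x + (k:ℕ))))⁻¹ := by
    intro x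
    rw [hLeq]
    apply HasDerivAt.deriv
    apply HasDerivAt.fun_sum
    intro k _
    have := (hrd (G (x + (k:ℕ)))).comp (x + (k:ℕ)) (hG (x + (k:ℕ)))
    exact HasDerivAt.comp_add_const x ((k:ℕ):ℝ) this
  refine ⟨?_, ?_, ?_⟩
  · rw [hLeq]
    apply ContDiff.sum
    intro k _
    exact hr.comp (hGC.comp (contDiff_id.add contDiff_const))
  · have := aux_int w G _ hG hG'c (fun x => (inv_pos.2 (hpos _)).le) hGw p hpc hψper
    simpa only [hq, div_eq_mul_inv] using this
  · have := aux_int w G _ hG hG'c (fun x => (inv_pos.2 (hpos _)).le) hGw v hvc hvper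
    simp only [hLd]
    refine this.trans ?_
    change _ ≤ _ + M / lam ^ 2 * ∫ x in (0:ℝ)..1, |p x|
    rw [← intervalIntegral.integral_const_mul, ← intervalIntegral.integral_const_mul,
      ← intervalIntegral.integral_add]
    · apply intervalIntegral.integral_mono_on zero_le_one
      · exact Continuous.intervalIntegrable (by fun_prop) _ _
      · exact Continuous.intervalIntegrable (by fun_prop) _ _
      · intro x _
        have hx := hexp x
        have hx0 := hpos x
        have hl0 : 0 < lam := by linarith
        have : v x = deriv p x / deriv F x - p x * deriv (deriv F) x / (deriv F x)^2 := by
          simp only [hv]; field_simp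
        rw [this]
        refine (abs_sub _ _).trans ?_
        rw [abs_div, abs_div, abs_mul, abs_of_pos hx0, abs_of_pos (pow_pos hx0 2)]
        have hM0 : 0 ≤ M := (abs_nonneg _).trans (hMb x)
        have a1 : |deriv p x| / deriv F x ≤ 1 / lam * |deriv p x| := by
          rw [one_div, mul_comm, ← div_eq_mul_inv]
          gcongr
        have a2 : |p x| * |deriv (deriv F) x| / deriv F x ^ 2 ≤ M / lam ^ 2 * |p x| := by
          rw [div_mul_eq_mul_div, mul_comm M]
          gcongr
          exact hMb x
        exact add_le_add a1 a2
    · exact Continuous.intervalIntegrable (by fun_prop) _ _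
    · exact Continuous.intervalIntegrable (by fun_prop) _ _

theorem uniform_L1_derivative_bound
    (F : ℝ → ℝ) (hF : ContDiff ℝ 2 F)
    (w : ℕ) (hw : 0 < w) (hFw : ∀ x : ℝ, F (x + 1) = F x + w)
    (T : UnitAddCircle → UnitAddCircle) (hT : ∀ x : ℝ, T ↑x = (↑(F x) : UnitAddCircle))
    (lam : ℝ) (hlam : 1 < lam) (hexp : ∀ x : ℝ, lam ≤ deriv F x)
    (nT'' : ℝ) (hnT'' : nT'' = ⨆ x : ℝ, |deriv (deriv F) x|)
    (Omega : ℝ) (hOmega : Omega = nT'' / (lam * (lam - 1)))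
    (T' : UnitAddCircle → ℝ) (hT'lift : ∀ x : ℝ, T' ↑x = deriv F x)
    (L : (UnitAddCircle → ℝ) → (UnitAddCircle → ℝ))
    (hL : ∀ u : UnitAddCircle → ℝ, ∀ x : UnitAddCircle,
      L u x = ∑' y : (T ⁻¹' {x}), u y / T' y)
    (ψ : UnitAddCircle → ℝ) (hψ : ContDiff ℝ 1 (fun x : ℝ => ψ ↑x)) :
    ∀ n : ℕ, ContDiff ℝ 1 (fun x : ℝ => (L^[n] ψ) ↑x) ∧
      (∫ x in (0:ℝ)..1, |deriv (fun y : ℝ => (L^[n] ψ) ↑y) x|) ≤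
        (1 / lam ^ n) * (∫ x in (0:ℝ)..1, |deriv (fun y : ℝ => ψ ↑y) x|)
          + Omega * ∫ x in (0:ℝ)..1, |ψ ↑x| := by
  have hstep := fun u hu => aux_step F hF w hw hFw T hT lam hlam hexp nT'' hnT'' T' hT'lift L hL u hu
  have hM0 : 0 ≤ nT'' := by rw [hnT'']; exact Real.iSup_nonneg fun x => abs_nonneg _
  have hl0 : 0 < lam := by linarith
  have hl1 : 0 < lam - 1 := by linarith
  set A := ∫ x in (0:ℝ)..1, |deriv (fun y : ℝ => ψ ↑y) x| with hA
  set B := ∫ x in (0:ℝ)..1, |ψ ↑x| with hB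
  have hB0 : 0 ≤ B := intervalIntegral.integral_nonneg zero_le_one fun x _ => abs_nonneg _
  have hO0 : 0 ≤ Omega := by rw [hOmega]; positivity
  have key : ∀ n : ℕ, ContDiff ℝ 1 (fun x : ℝ => (L^[n] ψ) ↑x) ∧
      (∫ x in (0:ℝ)..1, |(L^[n] ψ) ↑x|) ≤ B ∧
      (∫ x in (0:ℝ)..1, |deriv (fun y : ℝ => (L^[n] ψ) ↑y) x|) ≤ (1 / lam ^ n) * A + Omega * B := by
    intro n
    induction n with
    | zero =>
      refine ⟨hψ, le_rfl, ?_⟩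
      simp only [Function.iterate_zero, id, pow_zero, div_one, one_mul]
      nlinarith [mul_nonneg hO0 hB0]
    | succ n ih =>
      obtain ⟨i1, i2, i3⟩ := ih
      obtain ⟨s1, s2, s3⟩ := hstep _ i1
      rw [Function.iterate_succ_apply']
      refine ⟨s1, s2.trans i2, s3.trans ?_⟩
      calc _ ≤ 1 / lam * ((1 / lam ^ n) * A + Omega * B) + nT'' / lam ^ 2 * B := by gcongr
        _ = _ := by
          rw [hOmega]
          field_simp
          ring
  exact fun n => ⟨(key n).1, (key n).2.2⟩
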